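/- For a network N with binary collision profile and any T ≥ D*, the rate region equals the cycle-rate convex hull: R^N = conv({R_C : C a cycle of (M_T, E_T)}). -/

import Mathlib

open scoped Classical

open Filter

/-- Collision freeness for a binary collision profile. -/
def CollisionFreeB {L : Type*} (I : L → Set L) (D : L → L → ℤ)
    (S : L → ℤ → Bool) : Prop :=
  ∀ l t, S l t = true → ∀ l' ∈ I l, S l' (t + D l l') = false

/-- `blk S T k` is the `|L| × T` block of `S` with columns `kT, …, (k+1)T − 1`. -/
def blk {L : Type*} (S : L → ℤ → Bool) (T : ℕ) (k : ℤ) : L → Fin T → Bool :=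
  fun l j => S l (k * T + (j : ℕ))

/-- Vertex set of the scheduling graph (binary collision profile). -/
def MTb {L : Type*} (I : L → Set L) (D : L → L → ℤ) (T : ℕ) :
    Set (L → Fin T → Bool) :=
  {A | ∃ S, CollisionFreeB I D S ∧ A = blk S T 0}

/-- Edge set of the scheduling graph (binary collision profile). -/
def ETb {L : Type*} (I : L → Set L) (D : L → L → ℤ) (T : ℕ) :
    Set ((L → Fin T → Bool) × (L → Fin T → Bool)) :=
  {p | ∃ S, CollisionFreeB I D S ∧ p.1 = blk S T 0 ∧ p.2 = blk S T 1}

/-- A cycle of length `k` in the scheduling graph. -/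
def IsCycleB {L : Type*} (I : L → Set L) (D : L → L → ℤ) (T : ℕ)
    (k : ℕ) (C : ℕ → (L → Fin T → Bool)) : Prop :=
  1 ≤ k ∧ C k = C 0 ∧
  (∀ i < k, C i ∈ MTb I D T ∧ (C i, C (i + 1)) ∈ ETb I D T) ∧
  (∀ i < k, ∀ j < k, C i = C j → i = j)

/-- Rate vector `R_C` of a cycle of length `k`. -/
noncomputable def cycRate {L : Type*} (T k : ℕ) (C : ℕ → (L → Fin T → Bool)) :
    L → ℝ :=
  fun l => (∑ i ∈ Finset.range k, ∑ j : Fin T,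
      if C i l j then (1 : ℝ) else 0) / ((k : ℝ) * (T : ℝ))

/-- Average over `t = 0, …, T−1` of the indicator of collision-free activity. -/
noncomputable def rateAvgB {L : Type*} (I : L → Set L) (D : L → L → ℤ)
    (S : L → ℤ → Bool) (l : L) (T : ℕ) : ℝ :=
  (∑ t ∈ Finset.range T,
      if S l (t : ℤ) = true ∧ ∀ l' ∈ I l, S l' ((t : ℤ) + D l l') = false
      then (1 : ℝ) else 0) / T

/-- Achievability of a (nonnegative) rate vector. -/
noncomputable def AchievableB {L : Type*} (I : L → Set L) (D : L → L → ℤ)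
    (R : L → ℝ) : Prop :=
  ∀ ε : ℝ, 0 < ε → ∃ (S : L → ℤ → Bool) (r : L → ℝ),
    (∀ l, Tendsto (rateAvgB I D S l) atTop (nhds (r l))) ∧ ∀ l, R l - ε ≤ r l

namespace Rate14

noncomputable def cnt {L : Type*} (S : L → ℤ → Bool) (l : L) (n : ℕ) : ℝ :=
  ∑ t ∈ Finset.range n, if S l (t : ℤ) = true then (1 : ℝ) else 0

theorem cf_mono {L : Type*} {I : L → Set L} {D : L → L → ℤ} {S S' : L → ℤ → Bool}
    (h : CollisionFreeB I D S) (hs : ∀ l t, S' l t = true → S l t = true) :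
    CollisionFreeB I D S' := by
  intro l t hl l' hl'
  have h1 := h l t (hs l t hl) l' hl'
  by_contra hc
  have h2 := hs l' _ (by simpa using hc)
  simp [h1] at h2

theorem cf_shift {L : Type*} {I : L → Set L} {D : L → L → ℤ} {S : L → ℤ → Bool}
    (h : CollisionFreeB I D S) (a : ℤ) :
    CollisionFreeB I D (fun l t => S l (t + a)) := by
  intro l t hl l' hl'
  have h1 := h l (t + a) hl l' hl'
  have : t + D l l' + a = t + a + D l l' := by ring
  simpa [this] using h1

theorem edge_of_cf {L : Type*} {I : L → Set L} {D : L → L → ℤ} {S : L → ℤ → Bool}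
    (h : CollisionFreeB I D S) (T : ℕ) (q : ℤ) :
    (blk S T q, blk S T (q + 1)) ∈ ETb I D T := by
  refine ⟨_, cf_shift h (q * T), ?_, ?_⟩
  · funext l j
    simp only [blk]
    congr 1
    ring
  · funext l j
    simp only [blk]
    congr 1
    ring

theorem cf_of_edges {L : Type*} {I : L → Set L} {D : L → L → ℤ} {S : L → ℤ → Bool}
    {T : ℕ} (hT : 1 ≤ T) (hDT : ∀ l, ∀ l' ∈ I l, |D l l'| ≤ (T : ℤ))
    (h : ∀ q : ℤ, (blk S T q, blk S T (q + 1)) ∈ ETb I D T) : CollisionFreeB I D S := by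
  have key : ∀ q : ℤ, ∃ S0, CollisionFreeB I D S0 ∧
      ∀ l u, 0 ≤ u → u < 2 * (T : ℤ) → S l (q * T + u) = S0 l u := by
    intro q
    obtain ⟨S0, h0, h1, h2⟩ := h q
    refine ⟨S0, h0, fun l u hu hu2 => ?_⟩
    by_cases hlt : u < T
    · have := congrFun (congrFun h1 l) ⟨u.toNat, by omega⟩
      simp only [blk] at this
      rw [Int.toNat_of_nonneg hu] at this
      simpa using this
    · have := congrFun (congrFun h2 l) ⟨(u - T).toNat, by omega⟩
      simp only [blk] at this
      rw [Int.toNat_of_nonneg (by omega)] at this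
      convert this using 2 <;> ring
  intro l t hl l' hl'
  have hd := abs_le.1 (hDT l l' hl')
  have hTpos : (0 : ℤ) < T := by exact_mod_cast hT
  have e1 := Int.emod_add_mul_ediv t T
  have e2 := Int.emod_nonneg t hTpos.ne'
  have e3 := Int.emod_lt_of_pos t hTpos
  generalize t % (T : ℤ) = u at e1 e2 e3
  generalize t / (T : ℤ) = q at e1
  by_cases hc : 0 ≤ u + D l l'
  · obtain ⟨S0, h0, hS⟩ := key q
    have a1 := hS l u e2 (by omega)
    have a2 := hS l' (u + D l l') hc (by omega)
    have b1 : q * T + u = t := by rw [← e1]; ring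
    have b2 : q * T + (u + D l l') = t + D l l' := by rw [← e1]; ring
    rw [b1] at a1
    rw [b2] at a2
    rw [a2]
    exact h0 l u (by rw [← a1]; exact hl) l' hl'
  · obtain ⟨S0, h0, hS⟩ := key (q - 1)
    have a1 := hS l (u + T) (by omega) (by omega)
    have a2 := hS l' (u + T + D l l') (by omega) (by omega)
    have b1 : (q - 1) * T + (u + T) = t := by rw [← e1]; ring
    have b2 : (q - 1) * T + (u + T + D l l') = t + D l l' := by rw [← e1]; ring
    rw [b1] at a1
    rw [b2] at a2
    rw [a2]
    exact h0 l _ (by rw [← a1]; exact hl) l' hl'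

theorem sum_blocks (f : ℕ → ℝ) (T k : ℕ) :
    ∑ i ∈ Finset.range k, ∑ j : Fin T, f (i * T + j) = ∑ t ∈ Finset.range (k * T), f t := by
  induction k with
  | zero => simp
  | succ k ih =>
    rw [Finset.sum_range_succ, ih, Nat.succ_mul, Finset.sum_range_add,
      Fin.sum_univ_eq_sum_range (fun j => f (k * T + j))]

theorem periodic_sum (f : ℕ → ℝ) (p : ℕ) (hp : 1 ≤ p) (hf : ∀ n, f (n + p) = f n) :
    ∃ c : ℝ, ∀ N : ℕ, |∑ t ∈ Finset.range N, f t
      - N * ((∑ t ∈ Finset.range p, f t) / p)| ≤ c := by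
  set A := (∑ t ∈ Finset.range p, f t) / p with hA
  have hp0 : (p : ℝ) ≠ 0 := by positivity
  set g : ℕ → ℝ := fun N => ∑ t ∈ Finset.range N, f t - N * A with hg
  have hper : Function.Periodic g p := by
    intro N
    simp only [hg]
    rw [add_comm N p, Finset.sum_range_add]
    have : ∑ x ∈ Finset.range N, f (p + x) = ∑ x ∈ Finset.range N, f x :=
      Finset.sum_congr rfl fun x _ => by rw [add_comm, hf]
    rw [this]
    have : (p : ℝ) * A = ∑ t ∈ Finset.range p, f t := by rw [hA]; field_simp
    push_cast
    linarith
  refine ⟨∑ i ∈ Finset.range p, |g i|, fun N => ?_⟩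
  change |g N| ≤ _
  rw [← hper.map_mod_nat N]
  exact Finset.single_le_sum (f := fun i => |g i|) (fun i _ => abs_nonneg _)
    (Finset.mem_range.2 (Nat.mod_lt _ hp))

theorem periodic_tendsto (f : ℕ → ℝ) (p : ℕ) (hp : 1 ≤ p) (hf : ∀ n, f (n + p) = f n) :
    Tendsto (fun N : ℕ => (∑ t ∈ Finset.range N, f t) / N) atTop
      (nhds ((∑ t ∈ Finset.range p, f t) / p)) := by
  obtain ⟨c, hc⟩ := periodic_sum f p hp hf
  rw [tendsto_iff_norm_sub_tendsto_zero]
  refine squeeze_zero' (Eventually.of_forall fun _ => norm_nonneg _) ?_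
    (tendsto_const_div_atTop_nhds_zero_nat c)
  filter_upwards [eventually_ge_atTop 1] with N hN
  have hN0 : (0 : ℝ) < N := by exact_mod_cast hN
  rw [le_div_iff₀ hN0, Real.norm_eq_abs]
  calc _ = |((∑ t ∈ Finset.range N, f t) / N - (∑ t ∈ Finset.range p, f t) / p) * N| := by
        rw [abs_mul, abs_of_pos hN0]
    _ = |∑ t ∈ Finset.range N, f t - N * ((∑ t ∈ Finset.range p, f t) / p)| := by
        congr 1
        field_simp
    _ ≤ c := hc N

theorem rateAvg_cf {L : Type*} {I : L → Set L} {D : L → L → ℤ} {S : L → ℤ → Bool}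
    (h : CollisionFreeB I D S) (l : L) (n : ℕ) : rateAvgB I D S l n = cnt S l n / n := by
  unfold rateAvgB cnt
  congr 1
  refine Finset.sum_congr rfl fun t _ => ?_
  by_cases hs : S l t = true
  · rw [if_pos hs, if_pos ⟨hs, h l t hs⟩]
  · rw [if_neg hs, if_neg (fun h => hs h.1)]

/-- closed walks -/
def CW {L : Type*} (I : L → Set L) (D : L → L → ℤ) (T : ℕ)
    (k : ℕ) (C : ℕ → (L → Fin T → Bool)) : Prop :=
  1 ≤ k ∧ C k = C 0 ∧ ∀ i < k, (C i, C (i + 1)) ∈ ETb I D T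

abbrev hull {L : Type*} (I : L → Set L) (D : L → L → ℤ) (T : ℕ) : Set (L → ℝ) :=
  convexHull ℝ {R : L → ℝ | ∃ k C, IsCycleB I D T k C ∧ R = cycRate T k C}

theorem cw_hull {L : Type*} {I : L → Set L} {D : L → L → ℤ} {T : ℕ} (hT : 1 ≤ T) (k : ℕ) :
    ∀ C, CW I D T k C → cycRate T k C ∈ hull I D T := by
  induction k using Nat.strong_induction_on with
  | _ k ih =>
  intro C ⟨hk, hC0, hE⟩
  by_cases hinj : ∀ i < k, ∀ j < k, C i = C j → i = j
  · refine subset_convexHull ℝ _ ⟨k, C, ⟨hk, hC0, fun i hi => ⟨?_, hE i hi⟩, hinj⟩, rfl⟩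
    obtain ⟨S, h, h1, _⟩ := hE i hi
    exact ⟨S, h, h1⟩
  · have : ∃ i j, i < j ∧ j < k ∧ C i = C j := by
      push Not at hinj
      obtain ⟨i, hi, j, hj, h, hne⟩ := hinj
      rcases lt_or_gt_of_ne hne with h' | h'
      · exact ⟨i, j, h', hj, h⟩
      · exact ⟨j, i, h', hi, h.symm⟩
    obtain ⟨i, j, hij, hj, hc⟩ := this
    obtain ⟨d, rfl⟩ := Nat.exists_eq_add_of_lt hij
    obtain ⟨e, rfl⟩ := Nat.exists_eq_add_of_lt hj
    set C2 : ℕ → (L → Fin T → Bool) := fun n => if n ≤ i then C n else C (n + (d + 1)) with hC2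
    have h1 : CW I D T (d + 1) (fun n => C (i + n)) := by
      refine ⟨by omega, ?_, fun n hn => hE _ (by omega)⟩
      simpa [add_assoc] using hc.symm
    have h2 : CW I D T (i + (e + 1)) C2 := by
      refine ⟨by omega, ?_, fun n hn => ?_⟩
      · simp only [hC2]
        rw [if_neg (by omega), if_pos (by omega), ← hC0]
        congr 1
        omega
      · simp only [hC2]
        by_cases hn1 : n + 1 ≤ i
        · rw [if_pos (by omega), if_pos hn1]
          exact hE _ (by omega)
        · rw [if_neg hn1]
          by_cases hn2 : n ≤ i
          · obtain rfl : n = i := by omega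
            rw [if_pos hn2, hc]
            have := hE (n + d + 1) (by omega)
            convert this using 3
            omega
          · rw [if_neg hn2]
            have := hE (n + (d + 1)) (by omega)
            convert this using 3
            omega
    have m1 := ih _ (by omega) _ h1
    have m2 := ih _ (by omega) _ h2
    have hTp : (0 : ℝ) < T := by exact_mod_cast hT
    have hK : (0 : ℝ) < ((i : ℝ) + d + e + 2) := by positivity
    have := convex_convexHull ℝ {R : L → ℝ | ∃ k C, IsCycleB I D T k C ∧ R = cycRate T k C}
      m1 m2 (a := ((d : ℝ) + 1) / (i + d + e + 2)) (b := ((i : ℝ) + e + 1) / (i + d + e + 2))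
      (by positivity) (by positivity) (by field_simp; ring)
    convert this using 1
    funext l
    simp only [cycRate, Pi.add_apply, Pi.smul_apply, smul_eq_mul]
    have hsum : ∀ F : (L → Fin T → Bool) → ℝ,
        ∑ n ∈ Finset.range (i + d + 1 + e + 1), F (C n) =
        ∑ n ∈ Finset.range (d + 1), F (C (i + n)) +
          ∑ n ∈ Finset.range (i + (e + 1)), F (C2 n) := by
      intro F
      have : i + d + 1 + e + 1 = i + ((d + 1) + (e + 1)) := by ring
      rw [this, Finset.sum_range_add, Finset.sum_range_add _ (d + 1), Finset.sum_range_add _ i]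
      have a1 : ∑ n ∈ Finset.range i, F (C2 n) = ∑ n ∈ Finset.range i, F (C n) :=
        Finset.sum_congr rfl fun n hn => by
          simp only [hC2]
          rw [if_pos (Finset.mem_range.1 hn).le]
      have a2 : ∑ n ∈ Finset.range (e + 1), F (C2 (i + n)) =
          ∑ n ∈ Finset.range (e + 1), F (C (i + (d + 1 + n))) := by
        refine Finset.sum_congr rfl fun n hn => ?_
        simp only [hC2]
        by_cases h0 : n = 0
        · subst h0
          rw [if_pos (by omega)]
          simp only [add_zero]
          rw [hc]
          rfl
        · rw [if_neg (by omega)]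
          congr 2
          omega
      rw [a1, a2]
      ring
    rw [hsum (fun A => ∑ j : Fin T, if A l j = true then (1 : ℝ) else 0)]
    push_cast
    field_simp
    ring

theorem finite_rates {L : Type*} [Fintype L] (I : L → Set L) (D : L → L → ℤ) (T : ℕ) :
    {R : L → ℝ | ∃ k C, IsCycleB I D T k C ∧ R = cycRate T k C}.Finite := by
  set N := Fintype.card (L → Fin T → Bool) with hN
  refine (Set.finite_range (fun x : Fin (N + 1) × (Fin (N + 1) → (L → Fin T → Bool)) =>
    cycRate T x.1 (fun i => if h : i < N + 1 then x.2 ⟨i, h⟩ else fun _ _ => false))).subset ?_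
  rintro R ⟨k, C, ⟨_, _, _, hinj⟩, rfl⟩
  have hk : k ≤ N := by
    have := Fintype.card_le_of_injective (fun i : Fin k => C i)
      (fun i j h => Fin.ext (hinj i i.2 j j.2 h))
    rwa [Fintype.card_fin] at this
  refine ⟨(⟨k, by omega⟩, fun i => C i), ?_⟩
  funext l
  simp only [cycRate]
  congr 1
  refine Finset.sum_congr rfl fun i hi => ?_
  have := Finset.mem_range.1 hi
  rw [dif_pos (by omega)]

theorem cycRate_nonneg {L : Type*} (T k : ℕ) (C : ℕ → (L → Fin T → Bool)) (l : L) :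
    0 ≤ cycRate T k C l := by
  unfold cycRate
  refine div_nonneg (Finset.sum_nonneg fun i _ => Finset.sum_nonneg fun j _ => ?_)
    (by positivity)
  split_ifs <;> norm_num

theorem hull_nonneg {L : Type*} {I : L → Set L} {D : L → L → ℤ} {T : ℕ} {x : L → ℝ}
    (hx : x ∈ hull I D T) (l : L) : 0 ≤ x l := by
  have : hull I D T ⊆ Set.Ici 0 := by
    refine convexHull_min ?_ (convex_Ici _)
    rintro R ⟨k, C, _, rfl⟩ l
    exact cycRate_nonneg _ _ _ _
  exact this hx l

/-- zero out row `l0`. -/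
noncomputable def zl {L : Type*} (l0 : L) : (L → ℝ) →ₗ[ℝ] (L → ℝ) where
  toFun x := fun l => if l = l0 then 0 else x l
  map_add' x y := by
    funext l
    simp only [Pi.add_apply]
    split_ifs <;> simp
  map_smul' c x := by
    funext l
    simp

theorem hull_zero {L : Type*} {I : L → Set L} {D : L → L → ℤ} {T : ℕ} (hT : 1 ≤ T)
    (l0 : L) {x : L → ℝ} (hx : x ∈ hull I D T) : zl l0 x ∈ hull I D T := by
  have : hull I D T ⊆ (zl l0) ⁻¹' (hull I D T) := by
    refine convexHull_min ?_ ((convex_convexHull ℝ _).linear_preimage _)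
    rintro R ⟨k, C, ⟨hk, hC0, hE, _⟩, rfl⟩
    have : CW I D T k (fun i l j => if l = l0 then false else C i l j) := by
      refine ⟨hk, ?_, fun i hi => ?_⟩
      · simp only [hC0]
      · obtain ⟨S, h, h1, h2⟩ := (hE i hi).2
        simp only at h1 h2
        refine ⟨fun l t => if l = l0 then false else S l t, cf_mono h ?_, ?_, ?_⟩
        · intro l t
          split_ifs <;> simp
        · simp only [h1]
          rfl
        · simp only [h2]
          rfl
    have := cw_hull hT _ _ this
    change zl l0 _ ∈ hull I D T
    convert this using 1
    funext l
    simp only [zl, cycRate, LinearMap.coe_mk, AddHom.coe_mk]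
    by_cases hl : l = l0 <;> simp [hl]
  exact this hx

theorem hull_down {L : Type*} [Fintype L] {I : L → Set L} {D : L → L → ℤ} {T : ℕ} (hT : 1 ≤ T)
    {x y : L → ℝ} (hx : x ∈ hull I D T) (hy0 : ∀ l, 0 ≤ y l) (hy : ∀ l, y l ≤ x l) :
    y ∈ hull I D T := by
  have : ∀ s : Finset L, (fun l => if l ∈ s then y l else x l) ∈ hull I D T := by
    intro s
    induction s using Finset.induction_on with
    | empty => simpa using hx
    | insert a s ha ih =>
      have hz := hull_zero hT a ih
      by_cases hxa : x a = 0
      · convert ih using 1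
        funext l
        by_cases hl : l = a
        · subst hl
          have := hy l
          have := hy0 l
          simp [ha]
          linarith
        · simp [hl]
      · have hpos : 0 < x a := lt_of_le_of_ne ((hy0 a).trans (hy a)) (Ne.symm hxa)
        have := convex_convexHull ℝ _ ih hz (a := y a / x a) (b := 1 - y a / x a)
          (div_nonneg (hy0 a) hpos.le)
          (by rw [sub_nonneg, div_le_one hpos]; exact hy a) (by ring)
        convert this using 1
        funext l
        simp only [zl, LinearMap.coe_mk, AddHom.coe_mk, Pi.add_apply, Pi.smul_apply, smul_eq_mul]
        by_cases hl : l = a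
        · subst hl
          simp [ha]
          field_simp
        · simp only [Finset.mem_insert, hl, false_or, if_false]
          ring
  simpa using this Finset.univ

theorem ach_sub {L : Type*} [Fintype L] {I : L → Set L} {D : L → L → ℤ} {T : ℕ} (hT : 1 ≤ T)
    {R : L → ℝ} (hA : AchievableB I D R) {ε : ℝ} (hε : 0 < ε) :
    ∃ x ∈ hull I D T, ∀ l, R l - ε ≤ x l := by
  obtain ⟨S, r, hr, hRr⟩ := hA (ε / 3) (by positivity)
  set S1 : L → ℤ → Bool := fun l t =>
    if S l t = true ∧ ∀ l' ∈ I l, S l' (t + D l l') = false then true else false with hS1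
  have hcf : CollisionFreeB I D S1 := by
    intro l t hl l' hl'
    simp only [hS1, ite_eq_left_iff, Bool.false_eq_true, imp_false, not_not] at hl
    have := hl.2 l' hl'
    simp [hS1, this]
  have havg : ∀ l n, rateAvgB I D S l n = cnt S1 l n / n := by
    intro l n
    unfold rateAvgB cnt
    congr 1
    refine Finset.sum_congr rfl fun t _ => ?_
    by_cases h : S l t = true ∧ ∀ l' ∈ I l, S l' (t + D l l') = false
    · rw [if_pos h, if_pos]
      simp only [hS1]
      rw [if_pos h]
    · rw [if_neg h, if_neg]
      simp only [hS1]
      rw [if_neg h]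
      simp
  have ev : ∀ᶠ n in atTop, ∀ l, r l - ε / 3 < rateAvgB I D S l n := by
    rw [eventually_all]
    intro l
    exact (hr l).eventually_const_lt (by linarith)
  obtain ⟨N, hN⟩ := eventually_atTop.1 ev
  obtain ⟨M, hM⟩ := exists_nat_gt (3 / ε)
  set m := N + M with hm
  have hmT : N ≤ (m + 1) * T := by nlinarith
  set S2 : L → ℤ → Bool := fun l t =>
    if (T : ℤ) ≤ t ∧ t < (m + 1) * T then S1 l t else false with hS2
  have hcf2 : CollisionFreeB I D S2 := by
    refine cf_mono hcf fun l t => ?_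
    simp only [hS2]
    split_ifs <;> simp
  have hTp : (0 : ℝ) < T := by exact_mod_cast hT
  refine ⟨cycRate T (m + 1) (fun i => blk S2 T i), cw_hull hT _ _ ⟨by omega, ?_, fun i hi => ?_⟩,
    fun l => ?_⟩
  · funext l j
    simp only [blk, hS2]
    have := j.2
    rw [if_neg, if_neg]
    · push_cast
      omega
    · push_cast
      omega
  · exact_mod_cast edge_of_cf hcf2 T i
  · have h1 := hN _ hmT l
    have h2 := hRr l
    rw [havg] at h1
    have h3 : cycRate T (m + 1) (fun i => blk S2 T i) l = cnt S2 l ((m + 1) * T) /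
        (((m + 1) * T : ℕ) : ℝ) := by
      unfold cycRate cnt
      rw [← sum_blocks (fun t => if S2 l (t : ℤ) = true then (1 : ℝ) else 0)]
      simp only [blk]
      push_cast
      rfl
    have h4 : cnt S1 l ((m + 1) * T) - T ≤ cnt S2 l ((m + 1) * T) := by
      unfold cnt
      have e : (m + 1) * T = T + m * T := by ring
      rw [sub_le_iff_le_add, e, Finset.sum_range_add, Finset.sum_range_add]
      have b1 : ∑ t ∈ Finset.range T, (if S1 l (t : ℤ) = true then (1 : ℝ) else 0) ≤ T := by
        calc _ ≤ ∑ t ∈ Finset.range T, (1 : ℝ) :=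
              Finset.sum_le_sum fun t _ => by split_ifs <;> norm_num
          _ = T := by simp
      have b2 : 0 ≤ ∑ t ∈ Finset.range T, (if S2 l (t : ℤ) = true then (1 : ℝ) else 0) :=
        Finset.sum_nonneg fun t _ => by split_ifs <;> norm_num
      have b3 : ∑ x ∈ Finset.range (m * T),
            (if S1 l ((T + x : ℕ) : ℤ) = true then (1 : ℝ) else 0) =
          ∑ x ∈ Finset.range (m * T),
            (if S2 l ((T + x : ℕ) : ℤ) = true then (1 : ℝ) else 0) := by
        refine Finset.sum_congr rfl fun x hx => ?_
        have hx' : (x : ℤ) < m * T := by exact_mod_cast Finset.mem_range.1 hx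
        have : S2 l ((T + x : ℕ) : ℤ) = S1 l ((T + x : ℕ) : ℤ) := by
          simp only [hS2]
          rw [if_pos]
          push_cast
          constructor
          · omega
          · linarith
        rw [this]
      linarith
    have hq : (0 : ℝ) < (((m + 1) * T : ℕ) : ℝ) := by positivity
    have h5 : (cnt S1 l ((m + 1) * T) - T) / (((m + 1) * T : ℕ) : ℝ) ≤
        cnt S2 l ((m + 1) * T) / (((m + 1) * T : ℕ) : ℝ) := by gcongr
    rw [sub_div] at h5
    have h6 : (T : ℝ) / (((m + 1) * T : ℕ) : ℝ) ≤ ε / 3 := by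
      rw [div_le_iff₀ hq]
      rw [div_lt_iff₀ hε] at hM
      have : (M : ℝ) ≤ m := by rw [hm]; push_cast; linarith [(Nat.cast_nonneg N : (0 : ℝ) ≤ N)]
      push_cast
      have : 3 ≤ (m + 1 : ℝ) * ε := by nlinarith
      nlinarith
    rw [h3]
    linarith

/-- Good rate vectors. -/
def Good {L : Type*} (I : L → Set L) (D : L → L → ℤ) : Set (L → ℝ) :=
  {R | (∀ l, 0 ≤ R l) ∧ ∃ c : L → ℝ, ∀ n : ℕ, ∃ S, CollisionFreeB I D S ∧
    ∀ l, n * R l - c l ≤ cnt S l n}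

theorem good_cycle {L : Type*} {I : L → Set L} {D : L → L → ℤ}
    {T : ℕ} (hT : 1 ≤ T) (hDT : ∀ l, ∀ l' ∈ I l, |D l l'| ≤ (T : ℤ))
    {k : ℕ} {C : ℕ → (L → Fin T → Bool)} (hC : CW I D T k C) :
    cycRate T k C ∈ Good I D := by
  obtain ⟨hk, hC0, hE⟩ := hC
  have hTp : (0 : ℤ) < T := by exact_mod_cast hT
  have hkp : (0 : ℤ) < k := by exact_mod_cast hk
  have hfin : ∀ t : ℤ, (t % T).toNat < T := fun t => by
    have e2 := Int.emod_nonneg t hTp.ne'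
    have e3 := Int.emod_lt_of_pos t hTp
    omega
  set S : L → ℤ → Bool := fun l t => C ((t / T) % k).toNat l ⟨(t % T).toNat, hfin t⟩ with hS
  have hblk : ∀ q : ℤ, blk S T q = C (q % k).toNat := by
    intro q
    funext l j
    simp only [blk, hS]
    have hj : ((j : ℕ) : ℤ) < T := by exact_mod_cast j.2
    have hj0 : (0 : ℤ) ≤ ((j : ℕ) : ℤ) := by positivity
    have a1 : (q * T + (j : ℕ) : ℤ) / T = q := by
      rw [add_comm, Int.add_mul_ediv_right _ _ hTp.ne', Int.ediv_eq_zero_of_lt hj0 hj, zero_add]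
    have a2 : (q * T + (j : ℕ) : ℤ) % T = (j : ℕ) := by
      rw [add_comm, Int.add_mul_emod_self_right, Int.emod_eq_of_lt hj0 hj]
    simp [a1, a2]
  have hcf : CollisionFreeB I D S := by
    refine cf_of_edges hT hDT fun q => ?_
    rw [hblk, hblk]
    have e2 := Int.emod_nonneg q hkp.ne'
    have e3 := Int.emod_lt_of_pos q hkp
    have := hE (q % k).toNat (by omega)
    convert this using 2
    have e4 : (q + 1) % k = (q % k + 1) % k := by simp
    rw [e4]
    generalize q % (k : ℤ) = u at *
    by_cases hu : u + 1 < k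
    · rw [Int.emod_eq_of_lt (by omega) hu]
      congr 1
      omega
    · have : u + 1 = k := by omega
      rw [this, Int.emod_self]
      have : u.toNat + 1 = k := by omega
      rw [this, hC0]
      rfl
  refine ⟨fun l => cycRate_nonneg _ _ _ _, ?_⟩
  have hper : ∀ l (n : ℕ), (if S l ((n + k * T : ℕ) : ℤ) = true then (1 : ℝ) else 0) =
      if S l (n : ℤ) = true then (1 : ℝ) else 0 := by
    intro l n
    have : S l ((n + k * T : ℕ) : ℤ) = S l (n : ℤ) := by
      have a1 : ((n + k * T : ℕ) : ℤ) / T = n / T + k := by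
        push_cast
        rw [Int.add_mul_ediv_right _ _ hTp.ne']
      have a2 : ((n + k * T : ℕ) : ℤ) % T = n % T := by
        push_cast
        rw [Int.add_mul_emod_self_right]
      simp only [hS, a1, a2, Int.add_emod_right]
    rw [this]
  choose c hc using fun l => periodic_sum
    (fun n : ℕ => if S l (n : ℤ) = true then (1 : ℝ) else 0) (k * T) (Nat.mul_pos hk hT) (hper l)
  refine ⟨c, fun n => ⟨S, hcf, fun l => ?_⟩⟩
  have h1 := (abs_le.1 (hc l n)).1
  have h2 : (∑ t ∈ Finset.range (k * T), if S l (t : ℤ) = true then (1 : ℝ) else 0) /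
      ((k * T : ℕ) : ℝ) = cycRate T k C l := by
    rw [← sum_blocks (fun t => if S l (t : ℤ) = true then (1 : ℝ) else 0)]
    unfold cycRate
    push_cast
    congr 1
    refine Finset.sum_congr rfl fun i hi => Finset.sum_congr rfl fun j _ => ?_
    have h3 := congrFun (congrFun (hblk i) l) j
    have hi' : (i : ℤ) < k := by exact_mod_cast Finset.mem_range.1 hi
    rw [Int.emod_eq_of_lt (by positivity) hi'] at h3
    simp only [blk, Int.toNat_natCast] at h3
    rw [h3]
  rw [h2] at h1
  unfold cnt
  linarith

theorem good_convex {L : Type*} {I : L → Set L} {D : L → L → ℤ}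
    {T : ℕ} (hDT : ∀ l, ∀ l' ∈ I l, |D l l'| ≤ (T : ℤ)) :
    Convex ℝ (Good I D) := by
  rintro R1 ⟨hR1, c1, h1⟩ R2 ⟨hR2, c2, h2⟩ a b ha hb hab
  refine ⟨fun l => ?_, fun l => c1 l + c2 l + T + R1 l, fun n => ?_⟩
  · have := hR1 l
    have := hR2 l
    simp only [Pi.add_apply, Pi.smul_apply, smul_eq_mul]
    positivity
  · obtain ⟨n1, hn1⟩ : ∃ n1, n1 = ⌊a * n⌋₊ := ⟨_, rfl⟩
    have g1 : (n1 : ℝ) ≤ a * n := by rw [hn1]; exact Nat.floor_le (by positivity)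
    have g2 : a * n < n1 + 1 := by rw [hn1]; exact Nat.lt_floor_add_one _
    have g3 : n1 ≤ n := by
      have : (n1 : ℝ) ≤ n := g1.trans (by nlinarith [(Nat.cast_nonneg n : (0 : ℝ) ≤ n)])
      exact_mod_cast this
    obtain ⟨n2, rfl⟩ := Nat.exists_eq_add_of_le g3
    obtain ⟨S1, hS1, k1⟩ := h1 n1
    obtain ⟨S2, hS2, k2⟩ := h2 n2
    refine ⟨fun l t => if t < n1 then S1 l t else if t < n1 + T then false else S2 l (t - n1),
      ?_, fun l => ?_⟩
    · intro l t hl l' hl'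
      have hd := abs_le.1 (hDT l l' hl')
      have u1 := hS1 l t
      have u2 := hS2 l (t - n1)
      dsimp only at hl ⊢
      split_ifs at hl with p1 p2
      · have := u1 hl l' hl'
        split_ifs
        · exact this
        · rfl
        · omega
      · have := u2 hl l' hl'
        split_ifs
        · omega
        · rfl
        · rw [← this]
          congr 1
          ring
    · have k1 := k1 l
      have k2 := k2 l
      have r1 := hR1 l
      have r2 := hR2 l
      have e : cnt S1 l n1 + cnt S2 l n2 - T ≤ cnt (fun l t => if t < n1 then S1 l t else
          if t < n1 + T then false else S2 l (t - n1)) l (n1 + n2) := by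
        unfold cnt
        rw [Finset.sum_range_add]
        have b1 : ∀ t ∈ Finset.range n1, (if (if (t : ℤ) < n1 then S1 l t else
            if (t : ℤ) < n1 + T then false else S2 l (t - n1)) = true then (1 : ℝ) else 0) =
            if S1 l t = true then 1 else 0 := by
          intro t ht
          have : (t : ℤ) < n1 := by exact_mod_cast Finset.mem_range.1 ht
          rw [if_pos this]
        rw [Finset.sum_congr rfl b1]
        have b2 : ∑ t ∈ Finset.range n2, (if S2 l (t : ℤ) = true then (1 : ℝ) else 0) ≤
            ∑ t ∈ Finset.range n2, ((if (if ((n1 + t : ℕ) : ℤ) < n1 then S1 l ((n1 + t : ℕ) : ℤ)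
              else if ((n1 + t : ℕ) : ℤ) < n1 + T then false else
              S2 l (((n1 + t : ℕ) : ℤ) - n1)) = true then (1 : ℝ) else 0) +
              if t < T then 1 else 0) := by
          refine Finset.sum_le_sum fun t _ => ?_
          rw [if_neg (show ¬ ((n1 + t : ℕ) : ℤ) < n1 by push_cast; omega)]
          by_cases htT : t < T
          · rw [if_pos (show ((n1 + t : ℕ) : ℤ) < n1 + T by push_cast; omega), if_pos htT]
            split_ifs <;> norm_num
          · rw [if_neg (show ¬ ((n1 + t : ℕ) : ℤ) < n1 + T by push_cast; omega), if_neg htT]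
            have : ((n1 + t : ℕ) : ℤ) - n1 = t := by push_cast; ring
            rw [this, add_zero]
        rw [Finset.sum_add_distrib] at b2
        have b3 : ∑ t ∈ Finset.range n2, (if t < T then (1 : ℝ) else 0) ≤ T := by
          rw [← Finset.sum_filter, Finset.sum_const, nsmul_eq_mul, mul_one]
          have : ((Finset.range n2).filter (fun t => t < T)) ⊆ Finset.range T := by
            intro t ht
            simp at ht ⊢
            exact ht.2
          have := Finset.card_le_card this
          rw [Finset.card_range] at this
          exact_mod_cast this
        linarith
      refine le_trans ?_ e
      simp only [Pi.add_apply, Pi.smul_apply, smul_eq_mul]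
      push_cast at *
      have e1 : a * ((n1 : ℝ) + n2) * R1 l ≤ (n1 + 1) * R1 l := by gcongr
      have e2 : b * ((n1 : ℝ) + n2) ≤ n2 := by
        have : b = 1 - a := by linarith
        rw [this]
        linarith
      have e3 : b * ((n1 : ℝ) + n2) * R2 l ≤ n2 * R2 l := by gcongr
      linarith

theorem good_ach {L : Type*} [Fintype L] {I : L → Set L} {D : L → L → ℤ}
    {T : ℕ} (hDT : ∀ l, ∀ l' ∈ I l, |D l l'| ≤ (T : ℤ)) {R : L → ℝ} (hR : R ∈ Good I D) :
    AchievableB I D R := by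
  obtain ⟨hR0, c, hc⟩ := hR
  intro ε hε
  obtain ⟨n, hn1, hn⟩ : ∃ n : ℕ, 1 ≤ n ∧ ∀ l, T * R l + c l ≤ ε * n := by
    have : ∀ᶠ n : ℕ in atTop, 1 ≤ n ∧ ∀ l, T * R l + c l ≤ ε * n := by
      refine (eventually_ge_atTop 1).and ?_
      rw [eventually_all]
      intro l
      exact (tendsto_natCast_atTop_atTop.const_mul_atTop hε).eventually_ge_atTop _
    exact this.exists
  obtain ⟨S, hS, hcS⟩ := hc n
  set p : ℕ := n + T with hp
  have hpp : (0 : ℤ) < p := by omega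
  set S' : L → ℤ → Bool := fun l t => if t % p < n then S l (t % p) else false with hS'
  have hcf : CollisionFreeB I D S' := by
    intro l t hl l' hl'
    have hd := abs_le.1 (hDT l l' hl')
    simp only [hS'] at hl ⊢
    split_ifs at hl with h1
    split_ifs with h2
    · have e1 := Int.emod_add_mul_ediv t p
      have e2 := Int.emod_nonneg t hpp.ne'
      have f1 := Int.emod_add_mul_ediv (t + D l l') p
      have f2 := Int.emod_nonneg (t + D l l') hpp.ne'
      have := hS l _ hl l' hl'
      rw [← this]
      congr 1
      generalize t % (p : ℤ) = u at *
      generalize (t + D l l') % (p : ℤ) = u' at *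
      generalize t / (p : ℤ) = q at *
      generalize (t + D l l') / (p : ℤ) = q' at *
      have hq : q' = q := by
        have g : (p : ℤ) * (q' - q) = u - u' + D l l' := by linarith
        have hpe : (p : ℤ) = n + T := by rw [hp]; push_cast; ring
        have g1 : (p : ℤ) * (q' - q) < p * 1 := by rw [g]; omega
        have g2 : (p : ℤ) * (-1) < p * (q' - q) := by rw [g]; omega
        have := lt_of_mul_lt_mul_left g1 hpp.le
        have := lt_of_mul_lt_mul_left g2 hpp.le
        omega
      subst hq
      linarith
    · rfl
  refine ⟨S', fun l => cnt S' l p / p, fun l => ?_, fun l => ?_⟩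
  · have : rateAvgB I D S' l = fun N : ℕ => cnt S' l N / N := by
      funext N
      exact rateAvg_cf hcf l N
    rw [this]
    refine periodic_tendsto (fun t : ℕ => if S' l (t : ℤ) = true then (1 : ℝ) else 0) p
      (by omega) fun t => ?_
    have : S' l ((t + p : ℕ) : ℤ) = S' l t := by
      simp only [hS']
      push_cast
      simp only [Int.add_emod_right]
    rw [this]
  · have hpr : (0 : ℝ) < p := by exact_mod_cast hpp
    have hge : cnt S l n ≤ cnt S' l p := by
      unfold cnt
      rw [hp, Finset.sum_range_add]
      have b1 : ∀ t ∈ Finset.range n, (if S l (t : ℤ) = true then (1 : ℝ) else 0) =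
          if S' l (t : ℤ) = true then (1 : ℝ) else 0 := by
        intro t ht
        have h := Finset.mem_range.1 ht
        have : S' l (t : ℤ) = S l t := by
          simp only [hS']
          rw [Int.emod_eq_of_lt (by positivity) (by omega), if_pos (by omega)]
        rw [this]
      rw [Finset.sum_congr rfl b1]
      have b2 : 0 ≤ ∑ x ∈ Finset.range T,
          (if S' l ((n + x : ℕ) : ℤ) = true then (1 : ℝ) else 0) :=
        Finset.sum_nonneg fun t _ => by split_ifs <;> norm_num
      linarith
    dsimp only
    rw [le_div_iff₀ hpr]
    have h1 := hcS l
    have h2 := hn l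
    have hpe : (p : ℝ) = n + T := by rw [hp]; push_cast; ring
    have : 0 ≤ ε * T := by positivity
    rw [hpe]
    nlinarith

end Rate14

/-- binary collision profile, `T ≥ D*`; the rate region equals
the convex hull of the rate vectors of the cycles of `(M_T, E_T)`. -/
theorem stmt_14 {L : Type*} [Fintype L] (I : L → Set L) (D : L → L → ℤ)
    (T : ℕ) (hT : 1 ≤ T)
    (hDT : ∀ l, ∀ l' ∈ I l, |D l l'| ≤ (T : ℤ)) :
    {R : L → ℝ | (∀ l, 0 ≤ R l) ∧ AchievableB I D R} =
      convexHull ℝ {R : L → ℝ | ∃ k C, IsCycleB I D T k C ∧ R = cycRate T k C} := by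
  apply Set.Subset.antisymm
  · rintro R ⟨hR0, hA⟩
    have hclosed : IsClosed (Rate14.hull I D T) := (Rate14.finite_rates I D T).isClosed_convexHull ℝ
    change R ∈ Rate14.hull I D T
    rw [← hclosed.closure_eq, Metric.mem_closure_iff]
    intro ε hε
    obtain ⟨x, hx, hRx⟩ := Rate14.ach_sub hT hA (ε := ε / 2) (by positivity)
    refine ⟨fun l => max (R l - ε / 2) 0, Rate14.hull_down hT hx (fun l => le_max_right _ _)
      (fun l => max_le (hRx l) (Rate14.hull_nonneg hx l)), ?_⟩
    refine lt_of_le_of_lt ((dist_pi_le_iff (by positivity : 0 ≤ ε / 2)).2 fun l => ?_)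
      (half_lt_self hε)
    have := hR0 l
    rw [Real.dist_eq, abs_le]
    rcases max_cases (R l - ε / 2) 0 with ⟨h, h'⟩ | ⟨h, h'⟩ <;> rw [h] <;>
      constructor <;> linarith
  · have : convexHull ℝ {R : L → ℝ | ∃ k C, IsCycleB I D T k C ∧ R = cycRate T k C} ⊆
        Rate14.Good I D := by
      refine convexHull_min ?_ (Rate14.good_convex hDT)
      rintro R ⟨k, C, ⟨hk, hC0, hE, _⟩, rfl⟩
      exact Rate14.good_cycle hT hDT ⟨hk, hC0, fun i hi => (hE i hi).2⟩
    intro R hR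
    exact ⟨(this hR).1, Rate14.good_ach hDT (this hR)⟩
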